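/- Let P be a poset. Suppose δ, λ ∈ J(P) are finite order ideals with δ ⊆ λ such that every non-maximal element of δ is less than at least 2 maximal elements of δ. Then for every order ideal μ ∈ J(P) with μ ⊆ δ \ max(δ), the lattice J(λ \ μ) of order ideals of the subposet λ \ μ is an Atniss win if and only if J(λ) is an Atniss win. -/

import Mathlib

variable {L : Type*} [PartialOrder L]

/-- `ung x` is the set `{⋀({x} ∪ T) : T ⊆ cov x}` of results of Ungar moves applied to `x`. -/
def ung (x : L) : Set L :=
  {y | ∃ T : Set L, (∀ t ∈ T, t ⋖ x) ∧ IsGLB (insert x T) y}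

lemma ung_le {x y : L} (h : y ∈ ung x) : y ≤ x := by
  obtain ⟨T, -, hglb⟩ := h
  exact hglb.1 (Set.mem_insert x T)

attribute [local instance] WellFoundedLT.toWellFoundedRelation

mutual
  /-- `x` is an Atniss win: some element of `ung x \ {x}` is an Eeta win. -/
  def atnissWin [WellFoundedLT L] (x : L) : Prop :=
    ∃ y, ∃ _ : y ∈ ung x ∧ y ≠ x, eetaWin y
  termination_by x
  decreasing_by rename_i h; exact lt_of_le_of_ne (ung_le h.1) h.2

  /-- `x` is an Eeta win: every element of `ung x \ {x}` is an Atniss win. -/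
  def eetaWin [WellFoundedLT L] (x : L) : Prop :=
    ∀ y, (y ∈ ung x ∧ y ≠ x) → atnissWin y
  termination_by x
  decreasing_by rename_i h; exact lt_of_le_of_ne (ung_le h.1) h.2
end

/-- The lattice `J(P)` of finite order ideals of a poset `P`, ordered by inclusion. -/
abbrev FinIdeal (P : Type*) [PartialOrder P] : Type _ :=
  {I : Finset P // ∀ ⦃x⦄, x ∈ I → ∀ ⦃y⦄, y ≤ x → y ∈ I}

/-- The set of maximal elements of a finite subset of a poset. -/
def maxSet {P : Type*} [PartialOrder P] (s : Finset P) : Set P :=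
  {x | x ∈ s ∧ ∀ y ∈ s, x ≤ y → x = y}

/-- A `Fintype` instance for the elements of a skew shape `l \ m`. -/
instance skewFintype {P : Type*} [DecidableEq P] (s t : Finset P) :
    Fintype {p : P // p ∈ s ∧ p ∉ t} :=
  Fintype.subtype (s \ t) (by intro x; simp [Finset.mem_sdiff])

/-- The top element of the lattice of order ideals of a finite poset `Q`. -/
def fullIdeal (Q : Type*) [PartialOrder Q] [Fintype Q] : FinIdeal Q :=
  ⟨Finset.univ, fun x _ y _ => Finset.mem_univ y⟩

section Game

lemma atnissWin_iff_exists [WellFoundedLT L] (x : L) :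
    atnissWin x ↔ ∃ y ∈ ung x, y ≠ x ∧ eetaWin y := by
  rw [atnissWin]
  simp only [exists_prop, and_assoc]

lemma eetaWin_iff_not_atnissWin [WellFoundedLT L] (x : L) : eetaWin x ↔ ¬ atnissWin x := by
  induction x using WellFoundedLT.induction with
  | ind x ih =>
    rw [eetaWin, atnissWin_iff_exists]
    push Not
    refine forall_congr' fun y => ?_
    constructor
    · intro h hy hne
      rw [ih y (lt_of_le_of_ne (ung_le hy) hne), not_not]
      exact h ⟨hy, hne⟩
    · rintro h ⟨hy, hne⟩
      have := h hy hne
      rwa [ih y (lt_of_le_of_ne (ung_le hy) hne), not_not] at this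

/-- Strategy stealing: if every Ungar move from `y` can already be made from `x`, and `y` is
itself the result of a nontrivial Ungar move from `x`, then `x` is an Atniss win. -/
lemma atnissWin_of_ung_subset [WellFoundedLT L] {x y : L} (hy : y ∈ ung x) (hne : y ≠ x)
    (hsub : ung y ⊆ ung x) : atnissWin x := by
  rw [atnissWin_iff_exists]
  by_cases h : atnissWin y
  · obtain ⟨z, hz, hzy, hwin⟩ := (atnissWin_iff_exists y).1 h
    refine ⟨z, hsub hz, ?_, hwin⟩
    rintro rfl
    exact hzy (le_antisymm (ung_le hz) (ung_le hy))
  · exact ⟨y, hy, hne, (eetaWin_iff_not_atnissWin y).2 h⟩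

end Game

namespace FinIdeal

variable {P Q : Type*} [PartialOrder P] [PartialOrder Q]

open Classical in
/-- Removing a set of maximal elements from a finite order ideal. -/
noncomputable def remove (I : FinIdeal P) (T : Set P) (hT : T ⊆ maxSet I.val) : FinIdeal P :=
  ⟨I.val.filter (· ∉ T), by
    intro x hx y hyx
    rw [Finset.mem_filter] at hx ⊢
    refine ⟨I.2 hx.1 hyx, fun hy => hx.2 ?_⟩
    rwa [← (hT hy).2 x hx.1 hyx]⟩

lemma mem_remove {I : FinIdeal P} {T : Set P} {hT : T ⊆ maxSet I.val} {x : P} :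
    x ∈ (I.remove T hT).val ↔ x ∈ I.val ∧ x ∉ T := by
  simp [remove]

lemma remove_singleton_covBy {I : FinIdeal P} {x : P} (hx : x ∈ maxSet I.val) :
    I.remove {x} (Set.singleton_subset_iff.2 hx) ⋖ I := by
  refine ⟨lt_of_le_of_ne (fun y hy => (mem_remove.1 hy).1) fun h => ?_, fun K hK hKI => ?_⟩
  · have : x ∈ (I.remove {x} (Set.singleton_subset_iff.2 hx)).val := by rw [h]; exact hx.1
    exact (mem_remove.1 this).2 rfl
  · by_cases hxK : x ∈ K.val
    · refine hKI.not_ge fun y hy => ?_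
      by_cases hyx : y = x
      · rwa [hyx]
      · exact hK.le (mem_remove.2 ⟨hy, hyx⟩)
    · refine hK.not_ge fun y hy => mem_remove.2 ⟨hKI.le hy, ?_⟩
      rintro rfl
      exact hxK hy

lemma exists_mem_maxSet_of_lt {K I : FinIdeal P} (h : K < I) :
    ∃ x ∈ maxSet I.val, x ∉ K.val := by
  obtain ⟨x, hxI, hxK⟩ := Finset.not_subset.1 (show ¬ I.val ⊆ K.val from h.not_ge)
  obtain ⟨m, hxm, hm⟩ := I.val.exists_le_maximal hxI
  exact ⟨m, ⟨hm.1, fun y hy hmy => le_antisymm hmy (hm.2 hy hmy)⟩, fun hmK => hxK (K.2 hmK hxm)⟩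

lemma exists_eq_remove_of_covBy {K I : FinIdeal P} (h : K ⋖ I) :
    ∃ x, ∃ hx : x ∈ maxSet I.val, K = I.remove {x} (Set.singleton_subset_iff.2 hx) := by
  obtain ⟨x, hx, hxK⟩ := exists_mem_maxSet_of_lt h.lt
  refine ⟨x, hx, ?_⟩
  have hle : K ≤ I.remove {x} (Set.singleton_subset_iff.2 hx) := fun y hy =>
    mem_remove.2 ⟨h.le hy, by rintro rfl; exact hxK hy⟩
  exact (h.eq_or_eq hle (remove_singleton_covBy hx).le).elim Eq.symm
    fun h' => absurd h' (remove_singleton_covBy hx).ne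

lemma mem_ung_iff {I J : FinIdeal P} :
    J ∈ ung I ↔ J ≤ I ∧ ∀ x ∈ I.val, x ∉ J.val → x ∈ maxSet I.val := by
  constructor
  · rintro ⟨T, hT, hglb⟩
    refine ⟨hglb.1 (Set.mem_insert _ _), fun x hxI hxJ => ?_⟩
    by_contra hx
    let K : FinIdeal P := I.remove {z | z ∈ maxSet I.val ∧ z ∉ J.val} fun z hz => hz.1
    refine hxJ (hglb.2 (?_ : K ∈ lowerBounds _) (mem_remove.2 ⟨hxI, fun h => hx h.1⟩))
    rintro t (rfl | ht) y hy
    · exact (mem_remove.1 hy).1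
    · obtain ⟨z, hz, rfl⟩ := exists_eq_remove_of_covBy (hT t ht)
      refine mem_remove.2 ⟨(mem_remove.1 hy).1, ?_⟩
      rintro rfl
      exact (mem_remove.1 hy).2
        ⟨hz, fun h => (mem_remove.1 (hglb.1 (Set.mem_insert_of_mem _ ht) h)).2 rfl⟩
  · rintro ⟨hle, hmax⟩
    refine ⟨{K | K ⋖ I ∧ J ≤ K}, fun t ht => ht.1, ?_, fun K hK x hx => ?_⟩
    · rintro t (rfl | ht)
      exacts [hle, ht.2]
    · have hxI : x ∈ I.val := hK (Set.mem_insert _ _) hx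
      by_contra hxJ
      have hxm := hmax x hxI hxJ
      have hJ : J ≤ I.remove {x} (Set.singleton_subset_iff.2 hxm) := fun y hy =>
        mem_remove.2 ⟨hle hy, by rintro rfl; exact hxJ hy⟩
      exact (mem_remove.1
        (hK (Set.mem_insert_of_mem _ ⟨remove_singleton_covBy hxm, hJ⟩) hx)).2 rfl

lemma atnissWin_of_maxSet_remove_subset {I : FinIdeal P} {x : P} (hx : x ∈ maxSet I.val)
    (hsub : maxSet (I.remove {x} (Set.singleton_subset_iff.2 hx)).val ⊆ maxSet I.val) :
    atnissWin I := by
  have hcov := remove_singleton_covBy hx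
  refine atnissWin_of_ung_subset (mem_ung_iff.2 ⟨hcov.le, fun y hyI hy => ?_⟩) hcov.ne
    fun J hJ => ?_
  · have : y = x := by_contra fun h => hy (mem_remove.2 ⟨hyI, h⟩)
    rwa [this]
  · rw [mem_ung_iff] at hJ ⊢
    refine ⟨hJ.1.trans hcov.le, fun y hyI hyJ => ?_⟩
    by_cases hyx : y = x
    · rwa [hyx]
    · exact hsub (hJ.2 y (mem_remove.2 ⟨hyI, hyx⟩) hyJ)

/-- Every non-maximal element of `δ` is less than at least two maximal elements of `δ`. -/
def Branching (δ : FinIdeal P) : Prop :=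
  ∀ x ∈ δ.val, x ∉ maxSet δ.val →
    ∃ y ∈ maxSet δ.val, ∃ z ∈ maxSet δ.val, y ≠ z ∧ x < y ∧ x < z

lemma mem_maxSet_of_le {δ I : FinIdeal P} (h : δ ≤ I) {x : P} (hx : x ∈ δ.val)
    (hxI : x ∈ maxSet I.val) : x ∈ maxSet δ.val :=
  ⟨hx, fun y hy => hxI.2 y (h hy)⟩

lemma Branching.atnissWin {δ : FinIdeal P} (hδ : δ.Branching) (f : Q ↪o P) {A : FinIdeal Q}
    (hA : ∀ x ∈ maxSet δ.val, ∃ q ∈ A.val, f q = x) {q : Q} (hq : q ∈ maxSet A.val)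
    (hfq : f q ∈ δ.val) : atnissWin A := by
  refine atnissWin_of_maxSet_remove_subset hq fun a ha => ⟨(mem_remove.1 ha.1).1, ?_⟩
  intro b hb hab
  by_cases hbq : b = q
  swap
  · exact ha.2 b (mem_remove.2 ⟨hb, hbq⟩) hab
  subst hbq
  by_contra hne
  have hlt : f a < f b := f.lt_iff_lt.2 (lt_of_le_of_ne hab hne)
  have key : ∀ y ∈ maxSet δ.val, f a < y → y = f b := by
    intro y hy hay
    obtain ⟨c, hc, rfl⟩ := hA y hy
    by_contra hcb
    have hac : a < c := f.lt_iff_lt.1 hay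
    exact hac.ne (ha.2 c (mem_remove.2 ⟨hc, fun h => hcb (congrArg f h)⟩) hac.le)
  obtain ⟨y, hy, z, hz, hyz, hay, haz⟩ :=
    hδ (f a) (δ.2 hfq hlt.le) fun h => hlt.ne (h.2 _ hfq hlt.le)
  exact hyz ((key y hy hay).trans (key z hz haz).symm)

/-- If `I` is an ideal containing a branching ideal `δ`, then deleting from `I` a lower set of
non-maximal elements of `δ` does not change the winner. -/
lemma Branching.atnissWin_iff {δ : FinIdeal P} (hδ : δ.Branching) (f : Q ↪o P) (I : FinIdeal P) :
    ∀ A : FinIdeal Q, δ ≤ I → (∀ q, q ∈ A.val ↔ f q ∈ I.val) →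
      (∀ q, ∀ x ∈ I.val, f q ≤ x → x ∈ Set.range f) →
      (∀ x ∈ I.val, x ∉ Set.range f → x ∈ δ.val ∧ x ∉ maxSet δ.val) →
      (_root_.atnissWin A ↔ _root_.atnissWin I) := by
  classical
  induction I using WellFoundedLT.induction with
  | ind I ih =>
  intro A hδI hA hup hrange
  by_cases hex : ∃ x ∈ δ.val, x ∈ maxSet I.val
  · obtain ⟨x, hxδ, hx⟩ := hex
    have hcover : ∀ y ∈ maxSet δ.val, ∃ q ∈ A.val, f q = y := by
      intro y hy
      have hyI := hδI hy.1
      obtain ⟨q, rfl⟩ : y ∈ Set.range f := by_contra fun h => (hrange y hyI h).2 hy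
      exact ⟨q, (hA q).2 hyI, rfl⟩
    obtain ⟨q, hq, rfl⟩ := hcover x (mem_maxSet_of_le hδI hxδ hx)
    refine iff_of_true (hδ.atnissWin f hcover
      (q := q) ⟨hq, fun b hb hqb => f.injective (hx.2 _ ((hA b).1 hb) (f.le_iff_le.2 hqb))⟩ hxδ) ?_
    exact hδ.atnissWin (RelEmbedding.refl _)
      (fun y hy => ⟨y, hδI hy.1, rfl⟩) hx hxδ
  · have hmax : ∀ q, q ∈ maxSet A.val ↔ f q ∈ maxSet I.val := by
      refine fun q => ⟨fun hq => ⟨(hA q).1 hq.1, fun y hy hqy => ?_⟩, fun hq =>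
        ⟨(hA q).2 hq.1, fun b hb hqb =>
          f.injective (hq.2 _ ((hA b).1 hb) (f.le_iff_le.2 hqb))⟩⟩
      obtain ⟨b, rfl⟩ := hup q y hy hqy
      rw [hq.2 b ((hA b).2 hy) (f.le_iff_le.1 hqy)]
    have hstay : ∀ J ∈ ung I, δ ≤ J := fun J hJ x hx => by_contra fun hxJ =>
      hex ⟨x, hx, (mem_ung_iff.1 hJ).2 x (hδI hx) hxJ⟩
    have hih : ∀ J ∈ ung I, J ≠ I → ∀ B : FinIdeal Q, (∀ q, q ∈ B.val ↔ f q ∈ J.val) →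
        (eetaWin B ↔ eetaWin J) := by
      intro J hJ hne B hB
      rw [eetaWin_iff_not_atnissWin, eetaWin_iff_not_atnissWin,
        ih J (lt_of_le_of_ne (ung_le hJ) hne) B (hstay J hJ) hB
          (fun q x hx => hup q x (ung_le hJ hx)) (fun x hx => hrange x (ung_le hJ hx))]
    rw [atnissWin_iff_exists, atnissWin_iff_exists]
    constructor
    · rintro ⟨B, hBA, hne, hwin⟩
      have hBA' := mem_ung_iff.1 hBA
      let J : FinIdeal P := ⟨I.val.filter fun x => ∀ q, f q = x → q ∈ B.val, by
        intro x hx y hyx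
        rw [Finset.mem_filter] at hx ⊢
        refine ⟨I.2 hx.1 hyx, ?_⟩
        rintro q rfl
        obtain ⟨b, rfl⟩ := hup q x hx.1 hyx
        exact B.2 (hx.2 b rfl) (f.le_iff_le.1 hyx)⟩
      have hmemJ : ∀ x, x ∈ J.val ↔ x ∈ I.val ∧ ∀ q, f q = x → q ∈ B.val := by simp [J]
      have hB : ∀ q, q ∈ B.val ↔ f q ∈ J.val := by
        intro q
        rw [hmemJ]
        refine ⟨fun hq => ⟨(hA q).1 (hBA'.1 hq), fun b hb => ?_⟩, fun h => h.2 q rfl⟩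
        rwa [f.injective hb]
      have hJ : J ∈ ung I := by
        refine mem_ung_iff.2 ⟨fun x hx => ((hmemJ x).1 hx).1, fun x hxI hxJ => ?_⟩
        rw [hmemJ] at hxJ
        push Not at hxJ
        obtain ⟨q, rfl, hq⟩ := hxJ hxI
        exact (hmax q).1 (hBA'.2 q ((hA q).2 hxI) hq)
      have hJI : J ≠ I := fun h => hne <| Subtype.ext <| Finset.ext fun q => by
        rw [hB, hA, h]
      exact ⟨J, hJ, hJI, (hih J hJ hJI B hB).1 hwin⟩
    · rintro ⟨J, hJ, hne, hwin⟩
      have hJI := mem_ung_iff.1 hJ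
      let B : FinIdeal Q := ⟨A.val.filter fun q => f q ∈ J.val, by
        intro q hq b hbq
        rw [Finset.mem_filter] at hq ⊢
        exact ⟨A.2 hq.1 hbq, J.2 hq.2 (f.le_iff_le.2 hbq)⟩⟩
      have hB : ∀ q, q ∈ B.val ↔ f q ∈ J.val := by
        intro q
        simp only [B, Finset.mem_filter, and_iff_right_iff_imp, hA]
        exact fun h => hJI.1 h
      refine ⟨B, mem_ung_iff.2 ⟨fun q hq => (Finset.mem_filter.1 hq).1, fun q hq hqB => ?_⟩,
        fun h => hne ?_, (hih J hJ hne B hB).2 hwin⟩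
      · exact (hmax q).2 (hJI.2 _ ((hA q).1 hq) fun h => hqB ((hB q).2 h))
      · refine le_antisymm hJI.1 fun x hx => ?_
        by_contra hxJ
        have hxδ : x ∉ δ.val := fun h => hxJ (hstay J hJ h)
        obtain ⟨q, rfl⟩ : x ∈ Set.range f := by_contra fun h => hxδ (hrange x hx h).1
        exact hxJ ((hB q).1 (h ▸ (hA q).2 hx))

end FinIdeal

/-- Let `P` be a poset and let `δ ⊆ l` be finite order ideals of `P` such that every
non-maximal element of `δ` is less than at least 2 maximal elements of `δ`. Then for every
order ideal `μ ⊆ δ \ max(δ)`, the lattice `J(l \ μ)` of order ideals of the skew shape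
`l \ μ` is an Atniss win if and only if the lattice `J(l)` is an Atniss win. -/
theorem atnissWin_skew_iff {P : Type*} [PartialOrder P] [DecidableEq P]
    (δ l μ : FinIdeal P) (hdl : δ ≤ l)
    (hbranch : ∀ x ∈ δ.val, x ∉ maxSet δ.val →
      ∃ y ∈ maxSet δ.val, ∃ z ∈ maxSet δ.val, y ≠ z ∧ x < y ∧ x < z)
    (hμ : ∀ x ∈ μ.val, x ∈ δ.val ∧ x ∉ maxSet δ.val) :
    atnissWin (fullIdeal {p : P // p ∈ l.val ∧ p ∉ μ.val}) ↔
      atnissWin (fullIdeal {p : P // p ∈ l.val}) := by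
  have hδ : FinIdeal.Branching δ := hbranch
  refine (hδ.atnissWin_iff (OrderEmbedding.subtype _) l _ hdl ?_ ?_ ?_).trans
    (hδ.atnissWin_iff (OrderEmbedding.subtype _) l _ hdl ?_ ?_ ?_).symm
  · exact fun q => iff_of_true (Finset.mem_univ _) q.2.1
  · exact fun q x hx hqx => ⟨⟨x, hx, fun h => q.2.2 (μ.2 h hqx)⟩, rfl⟩
  · exact fun x hx hxr => hμ x (by_contra fun h => hxr ⟨⟨x, hx, h⟩, rfl⟩)
  · exact fun q => iff_of_true (Finset.mem_univ _) q.2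
  · exact fun q x hx _ => ⟨⟨x, hx⟩, rfl⟩
  · exact fun x hx hxr => absurd ⟨⟨x, hx⟩, rfl⟩ hxr
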